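/- arXiv:2007.05697 — 4 statements merged into one kernel-verified Lean document; each statement's English description precedes it below -/
import Mathlib

section
/- Let K be a field, E a finite-dimensional K-vector space, V a K-vector space, A a nilpotent endomorphism of E, B an endomorphism of V, and c ∈ K. Let C = A ⊗ id + id ⊗ B be the induced endomorphism of E ⊗ V. Then the maximal generalized eigenspace of C at c (the subspace of all t ∈ E ⊗ V annihilated by some power of C − c·id) equals the image of E ⊗ W in E ⊗ V under the canonical map, where W ⊆ V is the maximal generalized eigenspace of B at c. -/
open scoped TensorProduct

namespace Module.End

/-- Adding a commuting nilpotent endomorphism does not shrink maximal generalized eigenspaces. -/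
theorem maxGenEigenspace_le_add_of_isNilpotent {R M : Type*} [CommRing R] [AddCommGroup M]
    [Module R M] {f g : End R M} (h : Commute f g) (hg : IsNilpotent g) (c : R) :
    f.maxGenEigenspace c ≤ (f + g).maxGenEigenspace c := by
  intro x hx
  have hx' : x ∈ g.maxGenEigenspace 0 := by
    obtain ⟨n, hn⟩ := hg
    exact (mem_maxGenEigenspace g 0 x).2 ⟨n, by simp [hn]⟩
  simpa using genEigenspace_inf_le_add f g c 0 ⊤ ⊤ h ⟨hx, hx'⟩

/-- Adding a commuting nilpotent endomorphism does not change maximal generalized eigenspaces. -/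
theorem maxGenEigenspace_add_of_isNilpotent {R M : Type*} [CommRing R] [AddCommGroup M]
    [Module R M] {f g : End R M} (h : Commute f g) (hg : IsNilpotent g) (c : R) :
    (f + g).maxGenEigenspace c = f.maxGenEigenspace c := by
  refine le_antisymm ?_ (maxGenEigenspace_le_add_of_isNilpotent h hg c)
  have hc : Commute (f + g) (-g) := (h.add_left (Commute.refl g)).neg_right
  simpa using maxGenEigenspace_le_add_of_isNilpotent hc hg.neg c

/-- Tensoring with a flat module commutes with taking maximal generalized eigenspaces. -/
theorem maxGenEigenspace_lTensor {R E V : Type*} [CommRing R] [AddCommGroup E] [Module R E]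
    [Module.Flat R E] [AddCommGroup V] [Module R V] (B : End R V) (c : R) :
    maxGenEigenspace (LinearMap.lTensor E B : End R (E ⊗[R] V)) c =
      LinearMap.range (LinearMap.lTensor E (B.maxGenEigenspace c).subtype) := by
  have hpow (k : ℕ) : ((LinearMap.lTensor E B : End R (E ⊗[R] V)) - c • 1) ^ k =
      LinearMap.lTensor E ((B - c • 1) ^ k) := by
    rw [← LinearMap.lTensor_pow, LinearMap.lTensor_sub, LinearMap.lTensor_smul,
      Module.End.one_eq_id, Module.End.one_eq_id, LinearMap.lTensor_id]
  apply le_antisymm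
  · intro t ht
    obtain ⟨k, hk⟩ := (mem_maxGenEigenspace _ _ _).1 ht
    rw [hpow] at hk
    obtain ⟨s, rfl⟩ := (Module.Flat.lTensor_exact E
      (((B - c • 1) ^ k : End R V).exact_subtype_ker_map) t).1 hk
    have hle : LinearMap.ker ((B - c • 1) ^ k) ≤ B.maxGenEigenspace c := fun v hv =>
      (mem_maxGenEigenspace B c v).2 ⟨k, hv⟩
    refine ⟨LinearMap.lTensor E (Submodule.inclusion hle) s, ?_⟩
    rw [← LinearMap.lTensor_comp_apply, Submodule.subtype_comp_inclusion]
  · rintro _ ⟨s, rfl⟩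
    induction s with
    | zero => simp
    | add x y hx hy => rw [map_add]; exact add_mem hx hy
    | tmul e w =>
      obtain ⟨k, hk⟩ := (mem_maxGenEigenspace B c w).1 w.2
      refine (mem_maxGenEigenspace _ _ _).2 ⟨k, ?_⟩
      rw [hpow, LinearMap.lTensor_tmul, LinearMap.lTensor_tmul, Submodule.subtype_apply, hk,
        TensorProduct.tmul_zero]

end Module.End



/-- Let `K` be a field, `E` a finite-dimensional `K`-vector space, `V` a `K`-vector space,
`A` a nilpotent endomorphism of `E`, `B` an endomorphism of `V`, `c ∈ K`, and
`C = A ⊗ id + id ⊗ B` on `E ⊗ V`.  Then the maximal generalized eigenspace of `C` at `c`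
equals the image of `E ⊗ W` in `E ⊗ V`, where `W` is the maximal generalized eigenspace
of `B` at `c`. -/
theorem maxGenEigenspace_tensor
    {K : Type*} [Field K] {E V : Type*} [AddCommGroup E] [Module K E]
    [FiniteDimensional K E] [AddCommGroup V] [Module K V]
    (A : Module.End K E) (hA : IsNilpotent A) (B : Module.End K V) (c : K) :
    Module.End.maxGenEigenspace
        ((LinearMap.rTensor V A + LinearMap.lTensor E B : Module.End K (E ⊗[K] V))) c =
      LinearMap.range (TensorProduct.map (LinearMap.id : E →ₗ[K] E)
        (Module.End.maxGenEigenspace B c).subtype) := by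
  have hcomm : Commute (LinearMap.lTensor E B : Module.End K (E ⊗[K] V))
      (LinearMap.rTensor V A) := by
    change LinearMap.lTensor E B ∘ₗ LinearMap.rTensor V A =
      LinearMap.rTensor V A ∘ₗ LinearMap.lTensor E B
    rw [LinearMap.lTensor_comp_rTensor, LinearMap.rTensor_comp_lTensor]
  have hnil : IsNilpotent (LinearMap.rTensor V A : Module.End K (E ⊗[K] V)) := by
    obtain ⟨n, hn⟩ := hA
    exact ⟨n, by rw [LinearMap.rTensor_pow, hn, LinearMap.rTensor_zero]⟩
  rw [add_comm, Module.End.maxGenEigenspace_add_of_isNilpotent hcomm hnil,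
    Module.End.maxGenEigenspace_lTensor]
  rfl
end

section
/- Let g be a Lie algebra over ℂ, S ⊆ g a subset, f : S → ℂ a function, M a Lie module over g, and E a finite-dimensional Lie module over g such that toEnd x acting on E is a nilpotent endomorphism for every x ∈ S. For a Lie module N over g, let Γ(N) denote the subspace of all v ∈ N that are annihilated, for every x ∈ S, by some power of (toEnd x) − f(x)·id acting on N. Then, with respect to the tensor product Lie module structure on E ⊗ M, the subspace Γ(E ⊗ M) equals the image of E ⊗ Γ(M) in E ⊗ M under the canonical map. -/
open scoped TensorProduct

section GenEigenspace

variable {R E M : Type*} [CommRing R] [AddCommGroup E] [Module R E] [AddCommGroup M] [Module R M]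

lemma Module.End.maxGenEigenspace_le_add_of_isNilpotent_s4 {N T : Module.End R M}
    (hN : IsNilpotent N) (h : Commute N T) (μ : R) :
    T.maxGenEigenspace μ ≤ (N + T).maxGenEigenspace μ := by
  intro v hv
  obtain ⟨n, hn⟩ := hN
  rw [Module.End.mem_maxGenEigenspace] at hv ⊢
  obtain ⟨k, hk⟩ := hv
  have hc : Commute N (T - μ • (1 : Module.End R M)) :=
    h.sub_right ((Commute.one_right N).smul_right μ)
  refine ⟨n + k, ?_⟩
  rw [add_sub_assoc, hc.add_pow', LinearMap.sum_apply]
  refine Finset.sum_eq_zero fun p hp => ?_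
  rw [Finset.HasAntidiagonal.mem_antidiagonal] at hp
  rcases le_or_gt n p.1 with h1 | h1
  · simp [pow_eq_zero_of_le h1 hn]
  · have h2 : p.2 = (p.2 - k) + k := by lia
    rw [h2, pow_add, LinearMap.smul_apply, Module.End.mul_apply, Module.End.mul_apply, hk]
    simp

lemma Module.End.maxGenEigenspace_add_of_isNilpotent_s4 {N T : Module.End R M}
    (hN : IsNilpotent N) (h : Commute N T) (μ : R) :
    (N + T).maxGenEigenspace μ = T.maxGenEigenspace μ := by
  refine le_antisymm ?_ (maxGenEigenspace_le_add_of_isNilpotent_s4 hN h μ)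
  simpa using maxGenEigenspace_le_add_of_isNilpotent_s4 (T := N + T) hN.neg
    (((Commute.refl N).add_right h).neg_left) μ

lemma Module.End.mem_maxGenEigenspace_of_comp_eq {T : Module.End R E} {U : Module.End R M}
    {φ : E →ₗ[R] M} (h : φ ∘ₗ T = U ∘ₗ φ) {μ : R} {v : E} (hv : v ∈ T.maxGenEigenspace μ) :
    φ v ∈ U.maxGenEigenspace μ := by
  rw [Module.End.mem_maxGenEigenspace] at hv ⊢
  obtain ⟨k, hk⟩ := hv
  have hs : φ ∘ₗ (T - μ • (1 : Module.End R E)) = (U - μ • (1 : Module.End R M)) ∘ₗ φ := by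
    ext w
    simpa using LinearMap.congr_fun h w
  refine ⟨k, ?_⟩
  rw [← LinearMap.comp_apply, Module.End.commute_pow_left_of_commute hs.symm k,
    LinearMap.comp_apply, hk, map_zero]

variable {ι : Type*}

/-- The coefficient in `M` of the basis vector `b i` in an element of `E ⊗ M`. -/
noncomputable def Module.Basis.tensorCoord (b : Module.Basis ι R E) (M : Type*) [AddCommGroup M]
    [Module R M] (i : ι) : E ⊗[R] M →ₗ[R] M :=
  (TensorProduct.lid R M).toLinearMap ∘ₗ (b.coord i).rTensor M

lemma Module.Basis.tensorCoord_tmul (b : Module.Basis ι R E) (i : ι) (e : E) (m : M) :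
    b.tensorCoord M i (e ⊗ₜ m) = b.repr e i • m := by
  simp [tensorCoord]

lemma Module.Basis.sum_tmul_tensorCoord [Fintype ι] (b : Module.Basis ι R E) (t : E ⊗[R] M) :
    ∑ i, b i ⊗ₜ[R] b.tensorCoord M i t = t := by
  induction t with
  | zero => simp
  | add s t hs ht => simp only [map_add, TensorProduct.tmul_add, Finset.sum_add_distrib, hs, ht]
  | tmul e m =>
    simp only [tensorCoord_tmul, ← TensorProduct.smul_tmul, ← TensorProduct.sum_tmul, b.sum_repr]

lemma Module.Basis.mem_maxGenEigenspace_lTensor_iff [Fintype ι] (b : Module.Basis ι R E)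
    (T : Module.End R M) (μ : R) (t : E ⊗[R] M) :
    t ∈ Module.End.maxGenEigenspace (T.lTensor E) μ ↔
      ∀ i, b.tensorCoord M i t ∈ T.maxGenEigenspace μ := by
  refine ⟨fun ht i => Module.End.mem_maxGenEigenspace_of_comp_eq ?_ ht, fun ht => ?_⟩
  · ext e m
    simp [tensorCoord_tmul]
  · rw [← b.sum_tmul_tensorCoord t]
    refine Submodule.sum_mem _ fun i _ =>
      Module.End.mem_maxGenEigenspace_of_comp_eq (φ := TensorProduct.mk R E M (b i)) ?_ (ht i)
    ext m
    simp

lemma Module.Basis.mem_range_map_id_subtype_iff [Fintype ι] (b : Module.Basis ι R E)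
    (P : Submodule R M) (t : E ⊗[R] M) :
    t ∈ LinearMap.range (TensorProduct.map (LinearMap.id : E →ₗ[R] E) P.subtype) ↔
      ∀ i, b.tensorCoord M i t ∈ P := by
  constructor
  · rintro ⟨s, rfl⟩ i
    induction s with
    | zero => simp
    | add s t hs ht => simpa only [map_add] using P.add_mem hs ht
    | tmul e m => simpa [tensorCoord_tmul] using P.smul_mem _ m.2
  · intro ht
    rw [← b.sum_tmul_tensorCoord t]
    exact Submodule.sum_mem _ fun i _ => ⟨b i ⊗ₜ ⟨_, ht i⟩, by simp⟩

end GenEigenspace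

lemma TensorProduct.LieModule.toEnd_eq_rTensor_add_lTensor {R L E M : Type*} [CommRing R]
    [LieRing L] [LieAlgebra R L]
    [AddCommGroup E] [Module R E] [LieRingModule L E] [LieModule R L E]
    [AddCommGroup M] [Module R M] [LieRingModule L M] [LieModule R L M] (x : L) :
    LieModule.toEnd R L (E ⊗[R] M) x =
      (LieModule.toEnd R L E x).rTensor M + (LieModule.toEnd R L M x).lTensor E := by
  ext e m
  simp

lemma TensorProduct.LieModule.maxGenEigenspace_toEnd_of_isNilpotent {R L E M : Type*} [CommRing R]
    [LieRing L] [LieAlgebra R L]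
    [AddCommGroup E] [Module R E] [LieRingModule L E] [LieModule R L E]
    [AddCommGroup M] [Module R M] [LieRingModule L M] [LieModule R L M] {x : L}
    (hx : IsNilpotent (LieModule.toEnd R L E x)) (μ : R) :
    Module.End.maxGenEigenspace (LieModule.toEnd R L (E ⊗[R] M) x) μ =
      Module.End.maxGenEigenspace ((LieModule.toEnd R L M x).lTensor E) μ := by
  rw [TensorProduct.LieModule.toEnd_eq_rTensor_add_lTensor]
  refine Module.End.maxGenEigenspace_add_of_isNilpotent_s4 ?_ ?_ μ
  · obtain ⟨n, hn⟩ := hx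
    exact ⟨n, by rw [LinearMap.rTensor_pow, hn, LinearMap.rTensor_zero]⟩
  · ext e m
    simp

/-- Let `g` be a Lie algebra over `ℂ`, `S ⊆ g` a subset, `f : S → ℂ` a function, `M` a Lie
module over `g`, and `E` a finite-dimensional Lie module over `g` on which `toEnd x` is
nilpotent for every `x ∈ S`.  Writing `Γ(N)` for the subspace of vectors in `N` annihilated,
for every `x ∈ S`, by some power of `toEnd x - f x • 1` (i.e. the intersection of the
corresponding maximal generalized eigenspaces), we have `Γ(E ⊗ M) = image of E ⊗ Γ(M)`. -/
theorem gamma_tensor_eq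
    {g : Type*} [LieRing g] [LieAlgebra ℂ g]
    (S : Set g) (f : S → ℂ)
    {E M : Type*} [AddCommGroup E] [Module ℂ E] [LieRingModule g E] [LieModule ℂ g E]
    [FiniteDimensional ℂ E]
    [AddCommGroup M] [Module ℂ M] [LieRingModule g M] [LieModule ℂ g M]
    (hE : ∀ x : S, IsNilpotent (LieModule.toEnd ℂ g E (x : g))) :
    (⨅ x : S,
        Module.End.maxGenEigenspace (LieModule.toEnd ℂ g (E ⊗[ℂ] M) (x : g)) (f x)) =
      LinearMap.range (TensorProduct.map (LinearMap.id : E →ₗ[ℂ] E)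
        (⨅ x : S,
          Module.End.maxGenEigenspace (LieModule.toEnd ℂ g M (x : g)) (f x)).subtype) := by
  ext t
  let b := Module.finBasis ℂ E
  simp only [TensorProduct.LieModule.maxGenEigenspace_toEnd_of_isNilpotent (hE _), Submodule.mem_iInf,
    b.mem_maxGenEigenspace_lTensor_iff, b.mem_range_map_id_subtype_iff]
  exact forall_comm
end

section
/- Let E be a vector space over a field K, let V be a K-vector space, and let (W_i)_{i ∈ I} be a family of subspaces of V. Then, inside E ⊗ V, the intersection over i ∈ I of the images of the canonical maps E ⊗ W_i → E ⊗ V equals the image of the canonical map E ⊗ (⋂_{i ∈ I} W_i) → E ⊗ V. -/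
open scoped TensorProduct

/-- Over a free module `E` with basis `b`, a tensor lies in the image of `E ⊗ W → E ⊗ V` iff
all its coordinates with respect to `b` lie in `W`. -/
theorem mem_range_tensor_map_subtype_iff {R ι E V : Type*} [CommRing R] [DecidableEq ι]
    [AddCommGroup E] [Module R E] [AddCommGroup V] [Module R V] (b : Module.Basis ι R E)
    (W : Submodule R V) (x : E ⊗[R] V) :
    x ∈ LinearMap.range (TensorProduct.map (LinearMap.id : E →ₗ[R] E) W.subtype) ↔
      ∀ j, TensorProduct.equivFinsuppOfBasisLeft b x j ∈ W := by
  constructor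
  · rintro ⟨y, rfl⟩ j
    induction y with
    | zero => simp
    | tmul e w =>
      rw [TensorProduct.map_tmul, TensorProduct.equivFinsuppOfBasisLeft_apply_tmul_apply]
      exact W.smul_mem _ w.2
    | add y z hy hz =>
      rw [map_add, map_add, Finsupp.add_apply]
      exact W.add_mem hy hz
  · intro h
    rw [← (TensorProduct.equivFinsuppOfBasisLeft b).symm_apply_apply x,
      TensorProduct.equivFinsuppOfBasisLeft_symm_apply]
    exact Submodule.sum_mem _ fun j _ => ⟨b j ⊗ₜ ⟨_, h j⟩, by simp⟩

/-- Let `E` and `V` be vector spaces over a field `K` and `(W i)_{i ∈ I}` a family of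
subspaces of `V`.  Inside `E ⊗ V`, the intersection over `i` of the images of the canonical
maps `E ⊗ W i → E ⊗ V` equals the image of the canonical map `E ⊗ (⨅ i, W i) → E ⊗ V`. -/
theorem iInf_range_tensor_eq
    {K : Type*} [Field K] {E V : Type*} [AddCommGroup E] [Module K E]
    [AddCommGroup V] [Module K V] {I : Type*} (W : I → Submodule K V) :
    (⨅ i : I, LinearMap.range
        (TensorProduct.map (LinearMap.id : E →ₗ[K] E) (W i).subtype)) =
      LinearMap.range
        (TensorProduct.map (LinearMap.id : E →ₗ[K] E) (⨅ i : I, W i).subtype) := by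
  classical
  ext x
  simp only [Submodule.mem_iInf, mem_range_tensor_map_subtype_iff (Module.Basis.ofVectorSpace K E)]
  exact forall_comm
end

section
/- Let R and S be rings, let F and G be functors from the category of R-modules to the category of S-modules that preserve finite limits and finite colimits (i.e. are exact), and let η : F ⟶ G be a natural transformation such that the component of η at every simple R-module is an isomorphism. Then the component of η at every R-module of finite length is an isomorphism. -/
open CategoryTheory

theorem isIso_app_of_shortExact {C D : Type*} [Category* C] [Category* D] [Abelian C] [Abelian D]
    {F G : C ⥤ D} [F.PreservesZeroMorphisms] [G.PreservesZeroMorphisms]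
    [Limits.PreservesFiniteLimits F] [Limits.PreservesFiniteColimits F]
    [Limits.PreservesFiniteLimits G] [Limits.PreservesFiniteColimits G]
    (η : F ⟶ G) {T : ShortComplex C} (hT : T.ShortExact)
    [IsIso (η.app T.X₁)] [IsIso (η.app T.X₃)] : IsIso (η.app T.X₂) :=
  ShortComplex.isIso₂_of_shortExact_of_isIso₁₃' (T.mapNatTrans η)
    (hT.map_of_exact F) (hT.map_of_exact G) ‹_› ‹_›

/-- Let `R` and `S` be rings, `F` and `G` exact functors from `R`-modules to `S`-modules
(preserving finite limits and finite colimits), and `η : F ⟶ G` a natural transformation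
whose component at every simple `R`-module is an isomorphism.  Then the component of `η`
at every `R`-module of finite length is an isomorphism. -/
theorem natTrans_isIso_of_isIso_on_simples
    {R S : Type*} [Ring R] [Ring S]
    (F G : ModuleCat R ⥤ ModuleCat S)
    [Limits.PreservesFiniteLimits F] [Limits.PreservesFiniteColimits F]
    [Limits.PreservesFiniteLimits G] [Limits.PreservesFiniteColimits G]
    (η : F ⟶ G)
    (h : ∀ M : ModuleCat R, IsSimpleModule R M → IsIso (η.app M))
    (N : ModuleCat R) (hN : IsFiniteLength R N) :
    IsIso (η.app N) := by
  have : F.Additive := Functor.additive_of_preserves_binary_products _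
  have : G.Additive := Functor.additive_of_preserves_binary_products _
  suffices ∀ (M : Type _) [AddCommGroup M] [Module R M], IsFiniteLength R M →
      IsIso (η.app (.of R M)) from this N hN
  intro M _ _ hM
  induction hM with
  | @of_subsingleton M _ _ _ =>
    have hM : Limits.IsZero (ModuleCat.of R M) := ModuleCat.isZero_of_subsingleton _
    exact Limits.isIso_of_isTerminal
      (F.map_isZero hM).isTerminal (G.map_isZero hM).isTerminal _
  | @of_simple_quotient M _ _ K hK _ ih =>
    let T : ShortComplex (ModuleCat R) :=
      .mk (ModuleCat.ofHom K.subtype) (ModuleCat.ofHom K.mkQ) (by ext x; simp)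
    have hT : T.ShortExact := ModuleCat.shortComplex_shortExact T
      (LinearMap.exact_subtype_mkQ K) K.subtype_injective K.mkQ_surjective
    have : IsIso (η.app T.X₁) := ih
    have : IsIso (η.app T.X₃) := h _ hK
    exact isIso_app_of_shortExact η hT
end
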